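/- For any atomic proposition p, the atomic contraction rules (from Γ,p,p ⇒ Δ infer Γ,p ⇒ Δ, and from Γ ⇒ p,p,Δ infer Γ ⇒ p,Δ) are strongly admissible in Go_∞+cut: for each rule there exists a non-expansive adequate mapping u : P → P taking any ∞-proof of the premise to an ∞-proof of the conclusion with |u(π)| ≤ |π| for every π ∈ P. -/

import Mathlib

inductive Formula : Type
  | atom : ℕ → Formula
  | bot  : Formula
  | imp  : Formula → Formula → Formula
  | box  : Formula → Formula
deriving DecidableEq

def boxtimes (Γ : Multiset Formula) : Multiset Formula := Γ + Γ.map Formula.box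

inductive GoSeq : Bool → Multiset Formula → Multiset Formula → Prop
  | ax (c) (Γ Δ : Multiset Formula) (A : Formula) : GoSeq c (A ::ₘ Γ) (A ::ₘ Δ)
  | axBot (c) (Γ Δ : Multiset Formula) : GoSeq c (Formula.bot ::ₘ Γ) Δ
  | impL (c) (Γ Δ : Multiset Formula) (A B : Formula) :
      GoSeq c (B ::ₘ Γ) Δ → GoSeq c Γ (A ::ₘ Δ) → GoSeq c ((A.imp B) ::ₘ Γ) Δ
  | impR (c) (Γ Δ : Multiset Formula) (A B : Formula) :
      GoSeq c (A ::ₘ Γ) (B ::ₘ Δ) → GoSeq c Γ ((A.imp B) ::ₘ Δ)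
  | boxGo (c) (Γ Δ Θ : Multiset Formula) (A : Formula) :
      GoSeq c ((Formula.box (A.imp (Formula.box A))) ::ₘ boxtimes Θ) {A} →
      GoSeq c (Γ + Θ.map Formula.box) ((Formula.box A) ::ₘ Δ)
  | cut (Γ Δ : Multiset Formula) (A : Formula) :
      GoSeq true Γ (A ::ₘ Δ) → GoSeq true (A ::ₘ Γ) Δ → GoSeq true Γ Δ

inductive Frag : Bool → ℕ → Multiset Formula → Multiset Formula → Type
  | hole (c) (Γ Δ : Multiset Formula) : Frag c 0 Γ Δ
  | axP (c) (n) (Γ Δ : Multiset Formula) (p : ℕ) :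
      Frag c (n+1) (Formula.atom p ::ₘ Γ) (Formula.atom p ::ₘ Δ)
  | axBot (c) (n) (Γ Δ : Multiset Formula) : Frag c (n+1) (Formula.bot ::ₘ Γ) Δ
  | impL (c) (n) (Γ Δ : Multiset Formula) (A B : Formula) :
      Frag c (n+1) (B ::ₘ Γ) Δ → Frag c (n+1) Γ (A ::ₘ Δ) →
      Frag c (n+1) ((A.imp B) ::ₘ Γ) Δ
  | impR (c) (n) (Γ Δ : Multiset Formula) (A B : Formula) :
      Frag c (n+1) (A ::ₘ Γ) (B ::ₘ Δ) → Frag c (n+1) Γ ((A.imp B) ::ₘ Δ)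
  | box (c) (n) (Γ Δ Θ : Multiset Formula) (l : List Formula) (h : l ≠ []) :
      Frag c (n+1) (boxtimes Θ) (boxtimes (↑l)) →
      ((i : Fin l.length) → Frag c n (boxtimes Θ) {l.get i}) →
      Frag c (n+1) (Γ + Θ.map Formula.box) ((↑(l.map Formula.box) : Multiset Formula) + Δ)
  | cut (n) (Γ Δ : Multiset Formula) (A : Formula) :
      Frag true (n+1) Γ (A ::ₘ Δ) → Frag true (n+1) (A ::ₘ Γ) Δ → Frag true (n+1) Γ Δ

def Frag.trunc : ∀ {c : Bool} {n : ℕ} {Γ Δ : Multiset Formula}, Frag c (n+1) Γ Δ → Frag c n Γ Δ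
  | c, 0, Γ, Δ, _ => .hole c Γ Δ
  | c, n+1, _, _, .axP _ _ Γ Δ p => .axP c n Γ Δ p
  | c, n+1, _, _, .axBot _ _ Γ Δ => .axBot c n Γ Δ
  | c, n+1, _, _, .impL _ _ Γ Δ A B a b => .impL c n Γ Δ A B a.trunc b.trunc
  | c, n+1, _, _, .impR _ _ Γ Δ A B a => .impR c n Γ Δ A B a.trunc
  | c, n+1, _, _, .box _ _ Γ Δ Θ l h a bs => .box c n Γ Δ Θ l h a.trunc (fun i => (bs i).trunc)
  | _, n+1, _, _, .cut _ Γ Δ A a b => .cut n Γ Δ A a.trunc b.trunc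

def Frag.height : ∀ {c : Bool} {n : ℕ} {Γ Δ : Multiset Formula}, Frag c n Γ Δ → ℕ
  | _, _, _, _, .hole _ _ _ => 0
  | _, _, _, _, .axP _ _ _ _ _ => 0
  | _, _, _, _, .axBot _ _ _ _ => 0
  | _, _, _, _, .impL _ _ _ _ _ _ a b => max a.height b.height + 1
  | _, _, _, _, .impR _ _ _ _ _ _ a => a.height + 1
  | _, _, _, _, .box _ _ _ _ _ _ _ a bs =>
      max a.height (Finset.univ.sup fun i => (bs i).height) + 1
  | _, _, _, _, .cut _ _ _ _ a b => max a.height b.height + 1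

def Frag.cutFree : ∀ {c : Bool} {n : ℕ} {Γ Δ : Multiset Formula}, Frag c n Γ Δ → Prop
  | _, _, _, _, .hole _ _ _ => True
  | _, _, _, _, .axP _ _ _ _ _ => True
  | _, _, _, _, .axBot _ _ _ _ => True
  | _, _, _, _, .impL _ _ _ _ _ _ a b => a.cutFree ∧ b.cutFree
  | _, _, _, _, .impR _ _ _ _ _ _ a => a.cutFree
  | _, _, _, _, .box _ _ _ _ _ _ _ a bs => a.cutFree ∧ ∀ i, (bs i).cutFree
  | _, _, _, _, .cut _ _ _ _ _ _ => False

structure InfProof (c : Bool) (Γ Δ : Multiset Formula) : Type where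
  frag : ∀ n : ℕ, Frag c n Γ Δ
  compat : ∀ n : ℕ, (frag (n+1)).trunc = frag n

structure PP : Type where
  Γ : Multiset Formula
  Δ : Multiset Formula
  prf : InfProof true Γ Δ

def Sim : ℕ → PP → PP → Prop
  | 0, _, _ => True
  | n+1, π, τ => π.Γ = τ.Γ ∧ π.Δ = τ.Δ ∧ HEq (π.prf.frag (n+1)) (τ.prf.frag (n+1))

noncomputable def dP (π τ : PP) : ℝ :=
  sInf {r : ℝ | ∃ n : ℕ, Sim n π τ ∧ r = (1/2 : ℝ) ^ n}

def localHeight (π : PP) : ℕ := (π.prf.frag 1).height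

def Pmem (n : ℕ) (π : PP) : Prop := (π.prf.frag n).cutFree

def IsUltrametric {M : Type*} (d : M → M → ℝ) : Prop :=
  (∀ x y, 0 ≤ d x y) ∧ (∀ x y, d x y = 0 ↔ x = y) ∧ (∀ x y, d x y = d y x) ∧
  (∀ x y z, d x z ≤ max (d x y) (d y z))

def cBall {M : Type*} (d : M → M → ℝ) (x : M) (r : ℝ) : Set M := {y | d x y ≤ r}

def SphericallyComplete {M : Type*} (d : M → M → ℝ) : Prop :=
  ∀ (c : ℕ → M) (r : ℕ → ℝ), (∀ n, 0 ≤ r n) →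
    (∀ n, cBall d (c (n+1)) (r (n+1)) ⊆ cBall d (c n) (r n)) →
    ∃ x, ∀ n, x ∈ cBall d (c n) (r n)

def NonExpansive1 (u : PP → PP) : Prop := ∀ π τ, dP (u π) (u τ) ≤ dP π τ

def Adequate1 (u : PP → PP) : Prop := ∀ n π, Pmem n π → Pmem n (u π)

noncomputable def dPm {m : ℕ} (x y : Fin m → PP) : ℝ := ⨆ i, dP (x i) (y i)

def NonExpansiveM {m : ℕ} (u : (Fin m → PP) → PP) : Prop :=
  ∀ x y, dP (u x) (u y) ≤ dPm x y

def Fm (m : ℕ) : Type := {u : (Fin m → PP) → PP // NonExpansiveM u}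

def SimF {m : ℕ} (n k : ℕ) (a b : (Fin m → PP) → PP) : Prop :=
  (∀ x, Sim n (a x) (b x)) ∧
  (∀ x, (∑ i, localHeight (x i)) < k → Sim (n+1) (a x) (b x))

noncomputable def lm {m : ℕ} (a b : (Fin m → PP) → PP) : ℝ :=
  (1/2) * sInf {r : ℝ | ∃ n k : ℕ, SimF n k a b ∧ r = (1/2 : ℝ) ^ n + (1/2 : ℝ) ^ (n + k)}

noncomputable def dP2 (p q : PP × PP) : ℝ := max (dP p.1 q.1) (dP p.2 q.2)

def NonExpansive2 (u : PP × PP → PP) : Prop := ∀ p q, dP (u p) (u q) ≤ dP2 p q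

def Adequate2 (u : PP × PP → PP) : Prop :=
  ∀ n π τ, Pmem n π → Pmem n τ → Pmem n (u (π, τ))

def Removing (A : Formula) (u : PP × PP → PP) : Prop :=
  ∀ (Γ Δ : Multiset Formula) (π τ : PP),
    π.Γ = Γ → π.Δ = A ::ₘ Δ → τ.Γ = A ::ₘ Γ → τ.Δ = Δ →
    (u (π, τ)).Γ = Γ ∧ (u (π, τ)).Δ = Δ

def RA (A : Formula) : Type := {u : PP × PP → PP // NonExpansive2 u ∧ Removing A u}

def SimF2 (n k : ℕ) (a b : PP × PP → PP) : Prop :=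
  (∀ p, Sim n (a p) (b p)) ∧
  (∀ p : PP × PP, localHeight p.1 + localHeight p.2 < k → Sim (n+1) (a p) (b p))

noncomputable def l2 (a b : PP × PP → PP) : ℝ :=
  (1/2) * sInf {r : ℝ | ∃ n k : ℕ, SimF2 n k a b ∧ r = (1/2 : ℝ) ^ n + (1/2 : ℝ) ^ (n + k)}

namespace Multiset

variable {α : Type*} [DecidableEq α] {a : α} {s : Multiset α}

theorem erase_cons_of_two_le_count (b : α) (h : 2 ≤ (b ::ₘ s).count a) :
    (b ::ₘ s).erase a = b ::ₘ s.erase a := by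
  obtain rfl | hb := eq_or_ne a b
  · rw [count_cons_self] at h
    rw [erase_cons_head, cons_erase (count_pos.1 (by omega))]
  · exact erase_cons_tail _ hb.symm

theorem two_le_count_cons_of_two_le_count (b : α) (h : 2 ≤ s.count a) :
    2 ≤ (b ::ₘ s).count a :=
  h.trans (count_le_count_cons _ _ _)

theorem erase_cons_of_two_le_count_tail (b : α) (h : 2 ≤ s.count a) :
    (b ::ₘ s).erase a = b ::ₘ s.erase a :=
  erase_cons_of_two_le_count b (two_le_count_cons_of_two_le_count b h)

end Multiset

open Multiset

namespace Formula

theorem two_le_count_cons_of_cons_imp {p : ℕ} {A B : Formula} (C : Formula)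
    {Γ : Multiset Formula} (h : 2 ≤ (A.imp B ::ₘ Γ).count (atom p)) :
    2 ≤ (C ::ₘ Γ).count (atom p) := by
  rw [count_cons_of_ne (show atom p ≠ A.imp B by simp)] at h
  exact two_le_count_cons_of_two_le_count C h

theorem two_le_count_of_cons_imp {p : ℕ} {A B : Formula}
    {Γ : Multiset Formula} (h : 2 ≤ (A.imp B ::ₘ Γ).count (atom p)) :
    2 ≤ Γ.count (atom p) := by
  rwa [count_cons_of_ne (show atom p ≠ A.imp B by simp)] at h

theorem erase_add_map_box {p : ℕ} (Γ Θ : Multiset Formula) :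
    (Γ + Θ.map box).erase (atom p) = Γ.erase (atom p) + Θ.map box := by
  by_cases h : atom p ∈ Γ
  · exact erase_add_left_pos _ h
  · rw [erase_of_notMem h, erase_of_notMem (by simp [h])]

theorem erase_map_box_add {p : ℕ} (l : List Formula) (Δ : Multiset Formula) :
    ((↑(l.map box) : Multiset Formula) + Δ).erase (atom p) =
      (↑(l.map box) : Multiset Formula) + Δ.erase (atom p) := by
  rw [← map_coe, add_comm, erase_add_map_box, add_comm]

end Formula

namespace Frag

variable {c : Bool} {n p : ℕ} {Γ Γ' Δ Δ' : Multiset Formula}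

/-- Transport of a fragment along equalities of its end-sequent. -/
def copy (hΓ : Γ = Γ') (hΔ : Δ = Δ') (f : Frag c n Γ Δ) : Frag c n Γ' Δ' :=
  hΓ ▸ hΔ ▸ f

theorem trunc_copy (hΓ : Γ = Γ') (hΔ : Δ = Δ') (f : Frag c (n + 1) Γ Δ) :
    (f.copy hΓ hΔ).trunc = f.trunc.copy hΓ hΔ := by
  subst hΓ hΔ; rfl

@[simp] theorem height_copy (hΓ : Γ = Γ') (hΔ : Δ = Δ') (f : Frag c n Γ Δ) :
    (f.copy hΓ hΔ).height = f.height := by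
  subst hΓ hΔ; rfl

@[simp] theorem cutFree_copy (hΓ : Γ = Γ') (hΔ : Δ = Δ') (f : Frag c n Γ Δ) :
    (f.copy hΓ hΔ).cutFree ↔ f.cutFree := by
  subst hΓ hΔ; rfl

theorem eq_hole : ∀ f g : Frag c 0 Γ Δ, f = g
  | .hole _ _ _, .hole _ _ _ => rfl

/-- Contraction of two occurrences of the atom `p` in the antecedent. -/
def contractL (p : ℕ) : ∀ {c : Bool} {n : ℕ} {Γ Δ : Multiset Formula},
    Frag c n Γ Δ → 2 ≤ Γ.count (.atom p) → Frag c n (Γ.erase (.atom p)) Δ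
  | _, _, _, _, .hole c Γ Δ, _ => .hole c _ Δ
  | _, _, _, _, .axP c n Γ Δ q, hp =>
      (axP c n (Γ.erase (.atom p)) Δ q).copy (erase_cons_of_two_le_count _ hp).symm rfl
  | _, _, _, _, .axBot c n Γ Δ, hp =>
      (axBot c n (Γ.erase (.atom p)) Δ).copy (erase_cons_of_two_le_count _ hp).symm rfl
  | _, _, _, _, .impL c n Γ Δ A B a b, hp =>
      (impL c n (Γ.erase (.atom p)) Δ A B
        ((a.contractL p (Formula.two_le_count_cons_of_cons_imp B hp)).copy
          (erase_cons_of_two_le_count _ (Formula.two_le_count_cons_of_cons_imp B hp)) rfl)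
        (b.contractL p (Formula.two_le_count_of_cons_imp hp))).copy
        (erase_cons_of_two_le_count _ hp).symm rfl
  | _, _, _, _, .impR c n Γ Δ A B a, hp =>
      impR c n (Γ.erase (.atom p)) Δ A B
        ((a.contractL p (two_le_count_cons_of_two_le_count A hp)).copy
          (erase_cons_of_two_le_count_tail A hp) rfl)
  | _, _, _, _, .box c n Γ Δ Θ l h a bs, _ =>
      (box c n (Γ.erase (.atom p)) Δ Θ l h a bs).copy
        (Formula.erase_add_map_box Γ Θ).symm rfl
  | _, _, _, _, .cut n Γ Δ A a b, hp =>
      cut n (Γ.erase (.atom p)) Δ A (a.contractL p hp)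
        ((b.contractL p (two_le_count_cons_of_two_le_count A hp)).copy
          (erase_cons_of_two_le_count_tail A hp) rfl)

/-- Contraction of two occurrences of the atom `p` in the succedent. -/
def contractR (p : ℕ) : ∀ {c : Bool} {n : ℕ} {Γ Δ : Multiset Formula},
    Frag c n Γ Δ → 2 ≤ Δ.count (.atom p) → Frag c n Γ (Δ.erase (.atom p))
  | _, _, _, _, .hole c Γ Δ, _ => .hole c Γ _
  | _, _, _, _, .axP c n Γ Δ q, hp =>
      (axP c n Γ (Δ.erase (.atom p)) q).copy rfl (erase_cons_of_two_le_count _ hp).symm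
  | _, _, _, _, .axBot c n Γ Δ, _ => axBot c n Γ (Δ.erase (.atom p))
  | _, _, _, _, .impL c n Γ Δ A B a b, hp =>
      impL c n Γ (Δ.erase (.atom p)) A B (a.contractR p hp)
        ((b.contractR p (two_le_count_cons_of_two_le_count A hp)).copy rfl
          (erase_cons_of_two_le_count_tail A hp))
  | _, _, _, _, .impR c n Γ Δ A B a, hp =>
      (impR c n Γ (Δ.erase (.atom p)) A B
        ((a.contractR p (Formula.two_le_count_cons_of_cons_imp B hp)).copy rfl
          (erase_cons_of_two_le_count _ (Formula.two_le_count_cons_of_cons_imp B hp)))).copy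
        rfl (erase_cons_of_two_le_count _ hp).symm
  | _, _, _, _, .box c n Γ Δ Θ l h a bs, _ =>
      (box c n Γ (Δ.erase (.atom p)) Θ l h a bs).copy rfl
        (Formula.erase_map_box_add l Δ).symm
  | _, _, _, _, .cut n Γ Δ A a b, hp =>
      cut n Γ (Δ.erase (.atom p)) A
        ((a.contractR p (two_le_count_cons_of_two_le_count A hp)).copy rfl
          (erase_cons_of_two_le_count_tail A hp))
        (b.contractR p hp)

theorem trunc_contractL : ∀ {c : Bool} {n : ℕ} {Γ Δ : Multiset Formula}
    (f : Frag c (n + 1) Γ Δ) (hp : 2 ≤ Γ.count (.atom p)),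
    (f.contractL p hp).trunc = f.trunc.contractL p hp
  | _, 0, _, _, _, _ => eq_hole _ _
  | _, _ + 1, _, _, .axP _ _ _ _ _, hp
  | _, _ + 1, _, _, .axBot _ _ _ _, hp
  | _, _ + 1, _, _, .box _ _ _ _ _ _ _ _ _, hp => by simp only [contractL, trunc, trunc_copy]
  | _, _ + 1, _, _, .impL _ _ _ _ _ _ a b, hp
  | _, _ + 1, _, _, .cut _ _ _ _ a b, hp => by
    simp only [contractL, trunc, trunc_copy, trunc_contractL a, trunc_contractL b]
  | _, _ + 1, _, _, .impR _ _ _ _ _ _ a, hp => by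
    simp only [contractL, trunc, trunc_copy, trunc_contractL a]

theorem trunc_contractR : ∀ {c : Bool} {n : ℕ} {Γ Δ : Multiset Formula}
    (f : Frag c (n + 1) Γ Δ) (hp : 2 ≤ Δ.count (.atom p)),
    (f.contractR p hp).trunc = f.trunc.contractR p hp
  | _, 0, _, _, _, _ => eq_hole _ _
  | _, _ + 1, _, _, .axP _ _ _ _ _, hp
  | _, _ + 1, _, _, .axBot _ _ _ _, hp
  | _, _ + 1, _, _, .box _ _ _ _ _ _ _ _ _, hp => by simp only [contractR, trunc, trunc_copy]
  | _, _ + 1, _, _, .impL _ _ _ _ _ _ a b, hp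
  | _, _ + 1, _, _, .cut _ _ _ _ a b, hp => by
    simp only [contractR, trunc, trunc_copy, trunc_contractR a, trunc_contractR b]
  | _, _ + 1, _, _, .impR _ _ _ _ _ _ a, hp => by
    simp only [contractR, trunc, trunc_copy, trunc_contractR a]

theorem height_contractL (f : Frag c n Γ Δ) (hp : 2 ≤ Γ.count (.atom p)) :
    (f.contractL p hp).height = f.height := by
  induction f <;> simp_all [contractL, height]

theorem height_contractR (f : Frag c n Γ Δ) (hp : 2 ≤ Δ.count (.atom p)) :
    (f.contractR p hp).height = f.height := by
  induction f <;> simp_all [contractR, height]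

theorem cutFree_contractL (f : Frag c n Γ Δ) (hp : 2 ≤ Γ.count (.atom p)) :
    (f.contractL p hp).cutFree ↔ f.cutFree := by
  induction f <;> simp_all [contractL, cutFree]

theorem cutFree_contractR (f : Frag c n Γ Δ) (hp : 2 ≤ Δ.count (.atom p)) :
    (f.contractR p hp).cutFree ↔ f.cutFree := by
  induction f <;> simp_all [contractR, cutFree]

end Frag

theorem nonExpansive1_of_sim {u : PP → PP} (hu : ∀ n π τ, Sim n π τ → Sim n (u π) (u τ)) :
    NonExpansive1 u := by
  intro π τ
  refine csInf_le_csInf ⟨0, ?_⟩ ⟨_, 0, trivial, rfl⟩ ?_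
  · rintro r ⟨n, -, rfl⟩
    positivity
  · rintro r ⟨n, hn, rfl⟩
    exact ⟨n, hu n π τ hn, rfl⟩

/-- A family of maps on fragments with end-sequents in `S` which commutes with truncation and
preserves heights and cut-freeness induces a map on ∞-proofs. -/
theorem exists_nonExpansive1_of_frag (S : Multiset Formula → Multiset Formula → Prop)
    (e d : Multiset Formula → Multiset Formula)
    (f : ∀ {n : ℕ} {Γ Δ : Multiset Formula}, Frag true n Γ Δ → S Γ Δ → Frag true n (e Γ) (d Δ))
    (hf : ∀ {n : ℕ} {Γ Δ : Multiset Formula} (a : Frag true (n + 1) Γ Δ) (hS : S Γ Δ),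
      (f a hS).trunc = f a.trunc hS)
    (hheight : ∀ {n : ℕ} {Γ Δ : Multiset Formula} (a : Frag true n Γ Δ) (hS : S Γ Δ),
      (f a hS).height = a.height)
    (hcut : ∀ {n : ℕ} {Γ Δ : Multiset Formula} (a : Frag true n Γ Δ) (hS : S Γ Δ),
      (f a hS).cutFree ↔ a.cutFree) :
    ∃ u : PP → PP, NonExpansive1 u ∧ Adequate1 u ∧
      (∀ π : PP, S π.Γ π.Δ → (u π).Γ = e π.Γ ∧ (u π).Δ = d π.Δ) ∧
      (∀ π : PP, localHeight (u π) ≤ localHeight π) := by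
  classical
  let v (π : PP) (h : S π.Γ π.Δ) : PP :=
    ⟨e π.Γ, d π.Δ, fun n => f (π.prf.frag n) h, fun n => by rw [hf, π.prf.compat]⟩
  let u (π : PP) : PP := if h : S π.Γ π.Δ then v π h else π
  have hu (π : PP) (h : S π.Γ π.Δ) : u π = v π h := dif_pos h
  have hu' (π : PP) (h : ¬ S π.Γ π.Δ) : u π = π := dif_neg h
  refine ⟨u, nonExpansive1_of_sim ?_, ?_, fun π h => ?_, fun π => ?_⟩
  · rintro (_ | n) ⟨Γ, Δ, π⟩ ⟨Γ', Δ', τ⟩ hn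
    · trivial
    · obtain ⟨hΓ, hΔ, hfrag⟩ := hn
      dsimp only at hΓ hΔ hfrag
      subst hΓ hΔ
      by_cases h : S Γ Δ
      · rw [hu ⟨Γ, Δ, π⟩ h, hu ⟨Γ, Δ, τ⟩ h]
        exact ⟨rfl, rfl, heq_of_eq (congrArg (f · h) (eq_of_heq hfrag))⟩
      · rw [hu' ⟨Γ, Δ, π⟩ h, hu' ⟨Γ, Δ, τ⟩ h]
        exact ⟨rfl, rfl, hfrag⟩
  · intro n π hπ
    by_cases h : S π.Γ π.Δ
    · rw [hu π h]
      exact (hcut _ h).2 hπ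
    · rwa [hu' π h]
  · rw [hu π h]
    exact ⟨rfl, rfl⟩
  · by_cases h : S π.Γ π.Δ
    · rw [hu π h]
      exact (hheight _ h).le
    · rw [hu' π h]

theorem stmt15 (p : ℕ) :
    (∃ u : PP → PP, NonExpansive1 u ∧ Adequate1 u ∧
      (∀ (Γ Δ : Multiset Formula) (π : PP),
        π.Γ = Formula.atom p ::ₘ Formula.atom p ::ₘ Γ → π.Δ = Δ →
        (u π).Γ = Formula.atom p ::ₘ Γ ∧ (u π).Δ = Δ) ∧
      (∀ π : PP, localHeight (u π) ≤ localHeight π)) ∧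
    (∃ u : PP → PP, NonExpansive1 u ∧ Adequate1 u ∧
      (∀ (Γ Δ : Multiset Formula) (π : PP),
        π.Γ = Γ → π.Δ = Formula.atom p ::ₘ Formula.atom p ::ₘ Δ →
        (u π).Γ = Γ ∧ (u π).Δ = Formula.atom p ::ₘ Δ) ∧
      (∀ π : PP, localHeight (u π) ≤ localHeight π)) := by
  constructor
  · obtain ⟨u, hne, had, hu, hh⟩ := exists_nonExpansive1_of_frag
      (fun Γ _ => 2 ≤ Γ.count (.atom p)) (·.erase (.atom p)) id
      (Frag.contractL p) Frag.trunc_contractL Frag.height_contractL Frag.cutFree_contractL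
    refine ⟨u, hne, had, fun Γ Δ π hΓ hΔ => ?_, hh⟩
    simpa [hΓ, hΔ] using hu π (by simp [hΓ])
  · obtain ⟨u, hne, had, hu, hh⟩ := exists_nonExpansive1_of_frag
      (fun _ Δ => 2 ≤ Δ.count (.atom p)) id (·.erase (.atom p))
      (Frag.contractR p) Frag.trunc_contractR Frag.height_contractR Frag.cutFree_contractR
    refine ⟨u, hne, had, fun Γ Δ π hΓ hΔ => ?_, hh⟩
    simpa [hΓ, hΔ] using hu π (by simp [hΔ])
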